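/- Let R be a NAND-free k-ary Boolean relation and let F_1 and F_2 be two positive flip sequences that are valid at s ∈ R. If C(F_1) ∩ C(F_2) = ∅, then F_1 is valid at F_2(s) and F_2 is valid at F_1(s). -/

import Mathlib

def IsRestriction {k k' : ℕ} (R : Set (Fin k → Bool)) (R' : Set (Fin k' → Bool)) : Prop :=
  k' ≤ k ∧ ∃ X : Fin k → (Fin k' ⊕ Bool),
    ∀ r : Fin k' → Bool, r ∈ R' ↔ (fun i => Sum.elim r id (X i)) ∈ R

/-- The NAND relation `{01, 10, 00}`. -/
def nandRel : Set (Fin 2 → Bool) := {r | ¬(r 0 = true ∧ r 1 = true)}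

/-- The OR relation `{01, 10, 11}`. -/
def orRel : Set (Fin 2 → Bool) := {r | r 0 = true ∨ r 1 = true}

/-- The dual-Horn-clause relation `{0,1}^3 \ {100}`. -/
def dualHornRel : Set (Fin 3 → Bool) := {r | ¬(r 0 = true ∧ r 1 = false ∧ r 2 = false)}

/-- `R` is NAND-free if no restriction of `R` equals the NAND relation `{01,10,00}`. -/
def NANDFree {k : ℕ} (R : Set (Fin k → Bool)) : Prop := ¬ IsRestriction R nandRel

/-- `R` is OR-free if no restriction of `R` equals the OR relation `{01,10,11}`. -/
def ORFree {k : ℕ} (R : Set (Fin k → Bool)) : Prop := ¬ IsRestriction R orRel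

/-- `R` is dual-Horn-free if no restriction of `R` equals `{0,1}^3 \ {100}`. -/
def DualHornFree {k : ℕ} (R : Set (Fin k → Bool)) : Prop := ¬ IsRestriction R dualHornRel

/-- A flip is a variable together with the value it flips *to*:
`(i, true)` is the positive flip `xᵢ⁺` (0→1), `(i, false)` the negative flip `xᵢ⁻` (1→0). -/
abbrev Flip (α : Type) := α × Bool

/-- Apply a flip to an assignment. -/
def applyFlip {α : Type} [DecidableEq α] (a : α → Bool) (f : Flip α) : α → Bool :=
  Function.update a f.1 f.2

/-- Apply a flip sequence (left to right) to an assignment; `applySeq s F` is `F(s)`. -/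
def applySeq {α : Type} [DecidableEq α] (s : α → Bool) (F : List (Flip α)) : α → Bool :=
  F.foldl applyFlip s

/-- `ValidSeq R s F`: the flip sequence `F` is valid at `s` with respect to `R`, i.e.
each flip in turn is applicable and every intermediate assignment (including `s` and
the final one) lies in `R`. -/
def ValidSeq {α : Type} [DecidableEq α] (R : Set (α → Bool)) :
    (α → Bool) → List (Flip α) → Prop
  | s, [] => s ∈ R
  | s, f :: F => s ∈ R ∧ s f.1 = !f.2 ∧ ValidSeq R (applyFlip s f) F

theorem ValidSeq.mem {α : Type} [DecidableEq α] {R : Set (α → Bool)} {s : α → Bool}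
    {F : List (Flip α)} (h : ValidSeq R s F) : s ∈ R := by
  cases F with
  | nil => exact h
  | cons f F => exact h.1

theorem ValidSeq.applySeq_mem {α : Type} [DecidableEq α] {R : Set (α → Bool)} {s : α → Bool}
    {F : List (Flip α)} (h : ValidSeq R s F) : applySeq s F ∈ R := by
  induction F generalizing s with
  | nil => exact h
  | cons f F ih => exact ih h.2.2

theorem applyFlip_comm {α : Type} [DecidableEq α] {f g : Flip α} (h : f.1 ≠ g.1)
    (s : α → Bool) : applyFlip (applyFlip s f) g = applyFlip (applyFlip s g) f :=
  Function.update_comm (β := fun _ => Bool) h f.2 g.2 s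

theorem NANDFree.update_update_mem {k : ℕ} {R : Set (Fin k → Bool)} (hR : NANDFree R)
    {s : Fin k → Bool} {i j : Fin k} (hij : i ≠ j) (hi : s i = false) (hj : s j = false)
    (hs : s ∈ R) (hsi : Function.update s i true ∈ R) (hsj : Function.update s j true ∈ R) :
    Function.update (Function.update s i true) j true ∈ R := by
  by_contra hn
  refine hR ⟨by omega, fun l => if l = i then .inl 0 else if l = j then .inl 1 else .inr (s l),
    fun r => ?_⟩
  have key : (fun l => Sum.elim r id
      (if l = i then .inl 0 else if l = j then .inl 1 else .inr (s l))) =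
      Function.update (Function.update s i (r 0)) j (r 1) := by
    funext l
    by_cases hli : l = i
    · subst hli
      simp [Function.update_of_ne hij]
    · by_cases hlj : l = j
      · simp [hlj, hij.symm]
      · simp [hli, hlj]
  have hi' : Function.update s i false = s := by rw [← hi, Function.update_eq_self]
  have hj' : Function.update s j false = s := by rw [← hj, Function.update_eq_self]
  rw [key]
  cases h0 : r 0 <;> cases h1 : r 1
  · simpa [nandRel, h0, h1, hi', hj'] using hs
  · simpa [nandRel, h0, h1, hi'] using hsj
  · rw [Function.update_comm hij, hj']
    simpa [nandRel, h0, h1] using hsi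
  · simpa [nandRel, h0, h1] using hn

/-- A positive flip commutes with a valid positive flip sequence not containing it. -/
theorem ValidSeq.applyFlip_of_notMem {k : ℕ} {R : Set (Fin k → Bool)} (hR : NANDFree R)
    {f : Flip (Fin k)} (hf : f.2 = true) {F : List (Flip (Fin k))}
    (hF : ∀ g ∈ F, g.2 = true) (hfF : f ∉ F) {s : Fin k → Bool} (h : ValidSeq R s F)
    (hsf : s f.1 = false) (hmem : applyFlip s f ∈ R) :
    ValidSeq R (applyFlip s f) F ∧ applySeq s F f.1 = false ∧
      applySeq (applyFlip s f) F = applyFlip (applySeq s F) f := by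
  induction F generalizing s with
  | nil => exact ⟨hmem, hsf, rfl⟩
  | cons g G ih =>
    obtain ⟨hs, hsg, hG⟩ := h
    have hg : g.2 = true := hF g (by simp)
    have hne : f.1 ≠ g.1 := fun e =>
      hfF (by rw [show f = g from Prod.ext e (hf.trans hg.symm)]; simp)
    have hsg' : s g.1 = false := by simpa [hg] using hsg
    have hcomm := applyFlip_comm hne s
    have hsq : applyFlip (applyFlip s f) g ∈ R := by
      have hsgR := hG.mem
      unfold applyFlip at hmem hsgR ⊢
      rw [hf] at hmem ⊢
      rw [hg] at hsgR ⊢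
      exact hR.update_update_mem hne hsf hsg' hs hmem hsgR
    obtain ⟨h1, h2, h3⟩ := ih (fun x hx => hF x (by simp [hx])) (fun hx => hfF (by simp [hx])) hG
      (by simpa [applyFlip, Function.update_of_ne hne] using hsf) (hcomm ▸ hsq)
    refine ⟨⟨hmem, ?_, hcomm ▸ h1⟩, h2, ?_⟩
    · simpa [applyFlip, Function.update_of_ne hne.symm] using hsg
    · change applySeq (applyFlip (applyFlip s f) g) G = _
      rw [hcomm]
      exact h3

/-- Lemma 4: for `R` a NAND-free relation and `F₁`, `F₂` two positive flip sequences valid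
at `s ∈ R` with disjoint sets of flips, `F₁` is valid at `F₂(s)` and `F₂` is valid at
`F₁(s)`. -/
theorem disjoint_pos_seq_valid {k : ℕ} (R : Set (Fin k → Bool)) (hR : NANDFree R)
    (s : Fin k → Bool) (hs : s ∈ R) (F1 F2 : List (Flip (Fin k)))
    (hpos1 : ∀ f ∈ F1, f.2 = true) (hpos2 : ∀ f ∈ F2, f.2 = true)
    (h1 : ValidSeq R s F1) (h2 : ValidSeq R s F2)
    (hdisj : ∀ f ∈ F1, f ∉ F2) :
    ValidSeq R (applySeq s F2) F1 ∧ ValidSeq R (applySeq s F1) F2 := by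
  induction F1 generalizing s with
  | nil =>
    exact ⟨h2.applySeq_mem, h2⟩
  | cons f F ih =>
    obtain ⟨-, hsf, hF⟩ := h1
    have hf : f.2 = true := hpos1 f (by simp)
    obtain ⟨hv, hoff, hcomm⟩ := h2.applyFlip_of_notMem hR hf hpos2 (hdisj f (by simp))
      (by simpa [hf] using hsf) hF.mem
    obtain ⟨hl, hr⟩ := ih _ hF.mem (fun x hx => hpos1 x (by simp [hx])) hF hv
      (fun x hx => hdisj x (by simp [hx]))
    exact ⟨⟨h2.applySeq_mem, by simpa [hf] using hoff, hcomm ▸ hl⟩, hr⟩
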